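/- Let (Ω, ℱ, ℙ) be a probability space, d ≥ 1, R > 0, B_W ≥ 0, B_x ≥ 0. Let x : Ω → ℝ^d be a random vector with 𝔼[‖x‖₂²] ≤ 1 and 𝔼[‖x‖₂⁴] ≤ B_x⁴, let y : Ω → {−1, 1} be a random variable, and let N : Ω → ℝ^d be independent of (x, y) with independent coordinates, each N_i Gaussian with mean 0 and variance d/R. Then for every w ∈ ℝ^d with ‖w‖₂ ≤ B_W, 𝔼[ ‖ 2(⟨w, x + N⟩ − y)·(x + N) − (d/R)·w ‖₂² ] ≤ 32·B_W²·d³/R² + 98·B_W²·d²/R² + 32·B_W²·d²/R + 32·B_W²·d/R + 16·d²/R + 32·B_W²·B_x⁴ + 16. -/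

import Mathlib

open MeasureTheory ProbabilityTheory
open scoped NNReal

theorem integral_pow_four_gaussianReal (v : ℝ≥0) :
    ∫ x, x ^ 4 ∂gaussianReal 0 v = 3 * (v : ℝ) ^ 2 := by
  have hmgf : mgf id (gaussianReal 0 v) = fun t => Real.exp (v * t ^ 2 / 2) := by
    rw [mgf_id_gaussianReal]; simp
  have hderiv (p p' : ℝ → ℝ) (hp : ∀ t, HasDerivAt p (p' t) t) :
      deriv (fun t => p t * Real.exp (v * t ^ 2 / 2)) =
        fun t => (p' t + p t * (v * t)) * Real.exp (v * t ^ 2 / 2) := by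
    funext t
    have h : HasDerivAt (fun t : ℝ => (v : ℝ) * t ^ 2 / 2) (v * t) t := by
      refine (((hasDerivAt_pow 2 t).const_mul (v : ℝ)).div_const 2).congr_deriv ?_
      norm_num; ring
    exact (((hp t).mul h.exp).congr_deriv (by ring)).deriv
  have h0 : (fun t : ℝ => Real.exp (v * t ^ 2 / 2)) =
      fun t => (fun _ => (1 : ℝ)) t * Real.exp (v * t ^ 2 / 2) := by simp
  have key := iteratedDeriv_mgf_zero (X := id) (μ := gaussianReal 0 v) (by simp) 4
  rw [hmgf] at key
  simp only [iteratedDeriv_succ, iteratedDeriv_zero] at key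
  rw [h0, hderiv _ (fun _ => 0) (fun t => hasDerivAt_const t _),
    hderiv _ (fun _ => v) (fun t => by simpa using (hasDerivAt_id t).const_mul (v : ℝ)),
    hderiv _ (fun t => 2 * v ^ 2 * t) (fun t => ?_),
    hderiv _ (fun t => 3 * v ^ 2 + 3 * v ^ 3 * t ^ 2) (fun t => ?_)] at key
  · simp at key
    exact key.symm
  · refine ((((hasDerivAt_pow 3 t).const_mul ((v : ℝ) ^ 3)).add
      ((hasDerivAt_id' t).const_mul (3 * (v : ℝ) ^ 2))).congr_deriv
        (by push_cast; ring)).congr_of_eventuallyEq (.of_forall fun t => ?_)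
    simp only [Pi.add_apply]
    ring
  · refine ((((hasDerivAt_pow 2 t).const_mul ((v : ℝ) ^ 2)).const_add (v : ℝ)).congr_deriv
        (by push_cast; ring)).congr_of_eventuallyEq (.of_forall fun t => ?_)
    ring

section Moments

variable {Ω ι : Type*} [MeasurableSpace Ω] {μ : Measure Ω} {v : ℝ≥0}

theorem ProbabilityTheory.HasLaw.memLp_gaussianReal {X : Ω → ℝ} {m : ℝ} (hX : HasLaw X (gaussianReal m v) μ)
    (p : ENNReal) (hp : p ≠ ⊤) : MemLp X p μ := by
  have := memLp_id_gaussianReal' (μ := m) (v := v) p hp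
  rw [← hX.map_eq, memLp_map_measure_iff (by fun_prop) hX.aemeasurable] at this
  exact this

theorem MeasureTheory.MemLp.integrable_mul_mul_mul {f g h k : Ω → ℝ} (hf : MemLp f 4 μ) (hg : MemLp g 4 μ)
    (hh : MemLp h 4 μ) (hk : MemLp k 4 μ) :
    Integrable (fun ω => f ω * g ω * (h ω * k ω)) μ := by
  have : ENNReal.HolderTriple 4 4 2 := ⟨by
    rw [← two_mul, show (4 : ENNReal) = 2 * 2 by norm_num,
      ENNReal.mul_inv (by simp) (by simp), ← mul_assoc, ENNReal.mul_inv_cancel (by simp) (by simp), one_mul]⟩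
  have h1 : MemLp (f * g) 2 μ := hg.mul hf
  have h2 : MemLp (h * k) 2 μ := hk.mul hh
  exact h1.integrable_mul h2

theorem integral_sq_of_hasLaw {X : Ω → ℝ} (hX : HasLaw X (gaussianReal 0 v) μ) :
    ∫ ω, X ω ^ 2 ∂μ = v := by
  have h := variance_fun_id_gaussianReal (μ := 0) (v := v)
  rw [variance_of_integral_eq_zero (by fun_prop) integral_id_gaussianReal] at h
  rw [← h]
  exact hX.integral_comp (f := fun x => x ^ 2) (by fun_prop)

theorem integral_pow_four_of_hasLaw {X : Ω → ℝ} (hX : HasLaw X (gaussianReal 0 v) μ) :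
    ∫ ω, X ω ^ 4 ∂μ = 3 * (v : ℝ) ^ 2 := by
  rw [← integral_pow_four_gaussianReal]
  exact hX.integral_comp (f := fun x => x ^ 4) (by fun_prop)

theorem integral_eq_zero_of_hasLaw {X : Ω → ℝ} (hX : HasLaw X (gaussianReal 0 v) μ) :
    ∫ ω, X ω ∂μ = 0 := by
  rw [hX.integral_eq, integral_id_gaussianReal]

theorem identDistrib_sign_mul {N : Ω → ι → ℝ} [Countable ι]
    (hN : ∀ i, HasLaw (fun ω => N ω i) (gaussianReal 0 v) μ)
    (hind : iIndepFun (fun i ω => N ω i) μ) (ε : ι → ℝ) (hε : ∀ i, ε i = 1 ∨ ε i = -1) :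
    IdentDistrib N (fun ω i => ε i * N ω i) μ μ := by
  refine IdentDistrib.pi (X := fun i ω => N ω i) (Y := fun i ω => ε i * N ω i) (fun i => ?_) hind
    (hind.comp (fun i t => ε i * t) fun i => by fun_prop)
  rcases hε i with h | h
  · simpa [h] using IdentDistrib.refl (hN i).aemeasurable
  · simpa [h] using (hN i).identDistrib (by simpa [Pi.neg_def] using gaussianReal_neg (hN i))

theorem integral_mul_mul_sq_of_ne [Countable ι] {N : Ω → ι → ℝ}
    (hN : ∀ i, HasLaw (fun ω => N ω i) (gaussianReal 0 v) μ)
    (hind : iIndepFun (fun i ω => N ω i) μ) {j k : ι} (hjk : j ≠ k) (i : ι) :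
    ∫ ω, N ω j * N ω k * (N ω i * N ω i) ∂μ = 0 := by
  classical
  have hid := (identDistrib_sign_mul hN hind (fun l => if l = j then -1 else 1)
    fun l => by by_cases l = j <;> simp_all).comp
      (u := fun n => n j * n k * (n i * n i)) (by fun_prop)
  have h := hid.integral_eq
  have hneg : ∀ ω, ((fun n : ι → ℝ => n j * n k * (n i * n i)) ∘
      fun ω l => (if l = j then -1 else 1) * N ω l) ω = -(N ω j * N ω k * (N ω i * N ω i)) := by
    intro ω
    by_cases hij : i = j <;> simp [hij, hjk.symm]
  simp_rw [hneg, integral_neg, Function.comp_apply] at h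
  linarith

theorem integral_sq_mul_sq [DecidableEq ι] {N : Ω → ι → ℝ}
    (hN : ∀ i, HasLaw (fun ω => N ω i) (gaussianReal 0 v) μ)
    (hind : iIndepFun (fun i ω => N ω i) μ) (j i : ι) :
    ∫ ω, N ω j * N ω j * (N ω i * N ω i) ∂μ = (v : ℝ) ^ 2 * (1 + if i = j then 2 else 0) := by
  split_ifs with h
  · subst h
    rw [mul_comm, show (1 + 2 : ℝ) = 3 by norm_num, ← integral_pow_four_of_hasLaw (hN i)]
    congr with ω
    ring
  · have h2 : IndepFun (fun ω => N ω j * N ω j) (fun ω => N ω i * N ω i) μ :=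
      (hind.indepFun (Ne.symm h)).comp (φ := fun t => t * t) (ψ := fun t => t * t)
        (by fun_prop) (by fun_prop)
    have hm (l : ι) : AEStronglyMeasurable (fun ω => N ω l * N ω l) μ :=
      ((hN l).aemeasurable.mul (hN l).aemeasurable).aestronglyMeasurable
    rw [h2.integral_fun_mul_eq_mul_integral (hm j) (hm i)]
    simp_rw [← sq, integral_sq_of_hasLaw (hN _)]
    ring

section Vector

variable [Fintype ι] {N : Ω → ι → ℝ}

theorem integrable_linear_sq_mul_sum_sq
    (hN : ∀ i, HasLaw (fun ω => N ω i) (gaussianReal 0 v) μ) (w : ι → ℝ) :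
    Integrable (fun ω => (∑ j, w j * N ω j) ^ 2 * ∑ i, N ω i ^ 2) μ := by
  have h4 (i : ι) : MemLp (fun ω => N ω i) 4 μ := (hN i).memLp_gaussianReal 4 (by simp)
  have hw : MemLp (fun ω => ∑ j, w j * N ω j) 4 μ :=
    memLp_finsetSum _ fun j _ => (h4 j).const_mul (w j)
  simp_rw [Finset.mul_sum, sq]
  exact integrable_finsetSum _ fun i _ => hw.integrable_mul_mul_mul hw (h4 i) (h4 i)

theorem integral_linear_sq_mul_sum_sq
    (hN : ∀ i, HasLaw (fun ω => N ω i) (gaussianReal 0 v) μ)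
    (hind : iIndepFun (fun i ω => N ω i) μ) (w : ι → ℝ) :
    ∫ ω, (∑ j, w j * N ω j) ^ 2 * ∑ i, N ω i ^ 2 ∂μ =
      (Fintype.card ι + 2) * (v : ℝ) ^ 2 * ∑ j, w j ^ 2 := by
  classical
  have h4 (i : ι) : MemLp (fun ω => N ω i) 4 μ := (hN i).memLp_gaussianReal 4 (by simp)
  have hint (j k i : ι) :
      Integrable (fun ω => w j * w k * (N ω j * N ω k * (N ω i * N ω i))) μ :=
    ((h4 j).integrable_mul_mul_mul (h4 k) (h4 i) (h4 i)).const_mul _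
  have hexp (ω : Ω) : (∑ j, w j * N ω j) ^ 2 * ∑ i, N ω i ^ 2 =
      ∑ j, ∑ k, ∑ i, w j * w k * (N ω j * N ω k * (N ω i * N ω i)) := by
    rw [sq, Finset.sum_mul_sum, Finset.sum_mul]
    refine Finset.sum_congr rfl fun j _ => ?_
    rw [Finset.sum_mul]
    refine Finset.sum_congr rfl fun k _ => ?_
    rw [Finset.mul_sum]
    exact Finset.sum_congr rfl fun i _ => by ring
  simp_rw [hexp]
  rw [integral_finsetSum _ fun j _ => integrable_finsetSum _ fun k _ =>
    integrable_finsetSum _ fun i _ => hint j k i, Finset.mul_sum]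
  refine Finset.sum_congr rfl fun j _ => ?_
  rw [integral_finsetSum _ fun k _ => integrable_finsetSum _ fun i _ => hint j k i,
    Finset.sum_eq_single j, integral_finsetSum _ fun i _ => hint j j i]
  · simp_rw [integral_const_mul, integral_sq_mul_sq hN hind, ← Finset.mul_sum,
      Finset.sum_add_distrib]
    simp
    ring
  · intro k _ hkj
    rw [integral_finsetSum _ fun i _ => hint j k i]
    simp_rw [integral_const_mul, integral_mul_mul_sq_of_ne hN hind hkj.symm]
    simp
  · simp

theorem integrable_sum_sq (hN : ∀ i, HasLaw (fun ω => N ω i) (gaussianReal 0 v) μ) :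
    Integrable (fun ω => ∑ i, N ω i ^ 2) μ :=
  integrable_finsetSum _ fun i _ => ((hN i).memLp_gaussianReal 2 (by simp)).integrable_sq

theorem integral_sum_sq (hN : ∀ i, HasLaw (fun ω => N ω i) (gaussianReal 0 v) μ) :
    ∫ ω, ∑ i, N ω i ^ 2 ∂μ = Fintype.card ι * v := by
  rw [integral_finsetSum _ fun i _ =>
    ((hN i).memLp_gaussianReal 2 (by simp)).integrable_sq]
  simp [integral_sq_of_hasLaw (hN _)]

theorem integrable_linear_sq (hN : ∀ i, HasLaw (fun ω => N ω i) (gaussianReal 0 v) μ)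
    (w : ι → ℝ) : Integrable (fun ω => (∑ j, w j * N ω j) ^ 2) μ :=
  (memLp_finsetSum _ fun j _ =>
    ((hN j).memLp_gaussianReal 2 (by simp)).const_mul (w j)).integrable_sq

theorem integral_linear_sq (hN : ∀ i, HasLaw (fun ω => N ω i) (gaussianReal 0 v) μ)
    (hind : iIndepFun (fun i ω => N ω i) μ) (w : ι → ℝ) :
    ∫ ω, (∑ j, w j * N ω j) ^ 2 ∂μ = v * ∑ j, w j ^ 2 := by
  have h2 (i : ι) : MemLp (fun ω => N ω i) 2 μ := (hN i).memLp_gaussianReal 2 (by simp)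
  have hint (j k : ι) : Integrable (fun ω => w j * w k * (N ω j * N ω k)) μ :=
    ((h2 j).integrable_mul (h2 k)).const_mul _
  have hexp (ω : Ω) : (∑ j, w j * N ω j) ^ 2 = ∑ j, ∑ k, w j * w k * (N ω j * N ω k) := by
    rw [sq, Finset.sum_mul_sum]
    exact Finset.sum_congr rfl fun j _ => Finset.sum_congr rfl fun k _ => by ring
  simp_rw [hexp]
  rw [integral_finsetSum _ fun j _ => integrable_finsetSum _ fun k _ => hint j k, Finset.mul_sum]
  refine Finset.sum_congr rfl fun j _ => ?_
  rw [integral_finsetSum _ fun k _ => hint j k, Finset.sum_eq_single j]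
  · simp_rw [integral_const_mul, ← sq, integral_sq_of_hasLaw (hN _)]
    ring
  · intro k _ hkj
    rw [integral_const_mul, (hind.indepFun hkj.symm).integral_fun_mul_eq_mul_integral
      (h2 j).aestronglyMeasurable (h2 k).aestronglyMeasurable, integral_eq_zero_of_hasLaw (hN j)]
    simp
  · simp

end Vector

end Moments

theorem gradient_add_reflected_gradient_le {ι : Type*} [Fintype ι] (w x n : ι → ℝ) {y s : ℝ}
    (hy : y ^ 2 = 1) :
    ∑ i, (2 * ((∑ j, w j * (x j + n j)) - y) * (x i + n i) - s * w i) ^ 2 +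
      ∑ i, (2 * ((∑ j, w j * (x j + -n j)) - y) * (x i + -n i) - s * w i) ^ 2 ≤
    2 * ((32 * (∑ j, w j * x j) ^ 2 + 32 * (∑ j, w j * n j) ^ 2 + 16) *
      (∑ i, x i ^ 2 + ∑ i, n i ^ 2) + 2 * s ^ 2 * ∑ i, w i ^ 2) := by
  have hsum (m : ι → ℝ) : ∑ j, w j * (x j + m j) = ∑ j, w j * x j + ∑ j, w j * m j := by
    simp_rw [mul_add, Finset.sum_add_distrib]
  have hneg : ∑ j, w j * -n j = -∑ j, w j * n j := by simp
  rw [hsum n, hsum fun i => -n i, hneg]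
  set a := ∑ j, w j * x j
  set b := ∑ j, w j * n j
  have hcoef (b' : ℝ) (hb' : b' ^ 2 = b ^ 2) :
      (2 * (a + b' - y)) ^ 2 ≤ 16 * a ^ 2 + 16 * b ^ 2 + 8 := by
    nlinarith [sq_nonneg (a - b'), sq_nonneg (a + b' + y)]
  have hpt (b' : ℝ) (hb' : b' ^ 2 = b ^ 2) (t u : ℝ) :
      (2 * (a + b' - y) * t - s * u) ^ 2 ≤
        (32 * a ^ 2 + 32 * b ^ 2 + 16) * t ^ 2 + 2 * s ^ 2 * u ^ 2 := by
    nlinarith [sq_nonneg (2 * (a + b' - y) * t + s * u),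
      mul_le_mul_of_nonneg_right (hcoef b' hb') (sq_nonneg t)]
  simp only [← Finset.sum_add_distrib, Finset.mul_sum]
  refine Finset.sum_le_sum fun i _ => ?_
  linarith [hpt b rfl (x i + n i) (w i), hpt (-b) (by ring) (x i + -n i) (w i)]

/-- **Gradient second-moment bound under uniform allocation (Theorem 8).**
With square loss and uniform resource allocation, the measurement noise `N` has
independent centered Gaussian coordinates of variance `d/R` and is independent of the
data `(x,y)`; if `𝔼‖x‖² ≤ 1`, `𝔼‖x‖⁴ ≤ B_x⁴` and `y ∈ {−1,1}`, then for every `w` with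
`‖w‖₂ ≤ B_W` the stochastic gradient `∇ = 2(⟨w,x+N⟩−y)(x+N) − (d/R)w` satisfies
`𝔼‖∇‖² ≤ 32B_W²d³/R² + 98B_W²d²/R² + 32B_W²d²/R + 32B_W²d/R + 16d²/R + 32B_W²B_x⁴ + 16`. -/
theorem gradient_bound_uniform_allocation
    {Ω : Type*} [MeasurableSpace Ω] (μ : Measure Ω) [IsProbabilityMeasure μ]
    (d : ℕ) (hd : 1 ≤ d) (R BW Bx : ℝ) (hR : 0 < R) (hBW : 0 ≤ BW) (hBx : 0 ≤ Bx)
    (x : Ω → Fin d → ℝ) (y : Ω → ℝ) (N : Ω → Fin d → ℝ)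
    (hxmeas : Measurable x) (hymeas : Measurable y) (hNmeas : Measurable N)
    (hy : ∀ ω, y ω = 1 ∨ y ω = -1)
    (hx2int : Integrable (fun ω => ∑ i, (x ω i) ^ 2) μ)
    (hx4int : Integrable (fun ω => (∑ i, (x ω i) ^ 2) ^ 2) μ)
    (hx2 : ∫ ω, (∑ i, (x ω i) ^ 2) ∂μ ≤ 1)
    (hx4 : ∫ ω, (∑ i, (x ω i) ^ 2) ^ 2 ∂μ ≤ Bx ^ 4)
    (hindep : IndepFun (fun ω => (x ω, y ω)) N μ)
    (hNindep : iIndepFun (m := fun _ => (inferInstance : MeasurableSpace ℝ))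
      (fun i ω => N ω i) μ)
    (hNgauss : ∀ i, Measure.map (fun ω => N ω i) μ =
      gaussianReal 0 (Real.toNNReal ((d : ℝ) / R))) :
    ∀ w : Fin d → ℝ, Real.sqrt (∑ i, (w i) ^ 2) ≤ BW →
      ∫ ω, (∑ i,
          (2 * ((∑ j, w j * (x ω j + N ω j)) - y ω) * (x ω i + N ω i) -
            ((d : ℝ) / R) * w i) ^ 2) ∂μ ≤
        32 * BW ^ 2 * (d : ℝ) ^ 3 / R ^ 2 + 98 * BW ^ 2 * (d : ℝ) ^ 2 / R ^ 2 +
          32 * BW ^ 2 * (d : ℝ) ^ 2 / R + 32 * BW ^ 2 * (d : ℝ) / R +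
          16 * (d : ℝ) ^ 2 / R + 32 * BW ^ 2 * Bx ^ 4 + 16 := by
  intro w hw
  set s : ℝ := (d : ℝ) / R with hs
  have hs0 : 0 ≤ s := by positivity
  have hN (i : Fin d) : HasLaw (fun ω => N ω i) (gaussianReal 0 s.toNNReal) μ :=
    ⟨by fun_prop, hNgauss i⟩
  have hv : (s.toNNReal : ℝ) = s := Real.coe_toNNReal s hs0
  set W := ∑ i, w i ^ 2
  have hW0 : 0 ≤ W := Finset.sum_nonneg fun i _ => sq_nonneg _
  have hWB : W ≤ BW ^ 2 := by
    rw [← Real.sq_sqrt hW0]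
    exact pow_le_pow_left₀ (Real.sqrt_nonneg _) hw 2
  let grad : ((Fin d → ℝ) × ℝ) × (Fin d → ℝ) → ℝ := fun p =>
    ∑ i, (2 * ((∑ j, w j * (p.1.1 j + p.2 j)) - p.1.2) * (p.1.1 i + p.2 i) - s * w i) ^ 2
  have hgrad : Measurable grad := by fun_prop
  have hgrad0 (p) : 0 ≤ grad p := Finset.sum_nonneg fun i _ => sq_nonneg _
  let X : Ω → ℝ := fun ω => ∑ i, x ω i ^ 2
  let n : Ω → ℝ := fun ω => ∑ i, N ω i ^ 2
  let b : Ω → ℝ := fun ω => ∑ j, w j * N ω j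
  have hX0 (ω) : 0 ≤ X ω := Finset.sum_nonneg fun i _ => sq_nonneg _
  have hn0 (ω) : 0 ≤ n ω := Finset.sum_nonneg fun i _ => sq_nonneg _
  let K : Ω → ℝ := fun ω => 32 * W * X ω ^ 2 + 32 * W * (X ω * n ω) + 32 * (X ω * b ω ^ 2) +
    32 * (b ω ^ 2 * n ω) + 16 * X ω + 16 * n ω + 2 * s ^ 2 * W
  have hle (ω) : grad ((x ω, y ω), N ω) + grad ((x ω, y ω), fun i => -N ω i) ≤ 2 * K ω := by
    have hy2 : y ω ^ 2 = 1 := by rcases hy ω with h | h <;> simp [h]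
    refine (gradient_add_reflected_gradient_le w (x ω) (N ω) hy2).trans ?_
    have hcs : (∑ j, w j * x ω j) ^ 2 ≤ W * X ω := Finset.sum_mul_sq_le_sq_mul_sq _ _ _
    have := mul_le_mul_of_nonneg_right hcs (add_nonneg (hX0 ω) (hn0 ω))
    simp only [K, X, n, b] at this ⊢
    linarith
  have hX_n : IndepFun X n μ := hindep.comp
    (φ := fun p : (Fin d → ℝ) × ℝ => ∑ i, p.1 i ^ 2) (ψ := fun m : Fin d → ℝ => ∑ i, m i ^ 2)
    (by fun_prop) (by fun_prop)
  have hX_b : IndepFun X (fun ω => b ω ^ 2) μ := hindep.comp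
    (φ := fun p : (Fin d → ℝ) × ℝ => ∑ i, p.1 i ^ 2)
    (ψ := fun m : Fin d → ℝ => (∑ j, w j * m j) ^ 2) (by fun_prop) (by fun_prop)
  have hn : Integrable n μ := integrable_sum_sq hN
  have hb : Integrable (fun ω => b ω ^ 2) μ := integrable_linear_sq hN w
  have i1 : Integrable (fun ω => 32 * W * X ω ^ 2) μ := hx4int.const_mul _
  have i2 : Integrable (fun ω => 32 * W * (X ω * n ω)) μ :=
    (hX_n.integrable_mul hx2int hn).const_mul _
  have i3 : Integrable (fun ω => 32 * (X ω * b ω ^ 2)) μ :=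
    (hX_b.integrable_mul hx2int hb).const_mul _
  have i4 : Integrable (fun ω => 32 * (b ω ^ 2 * n ω)) μ :=
    (integrable_linear_sq_mul_sum_sq hN w).const_mul _
  have i5 : Integrable (fun ω => 16 * X ω) μ := hx2int.const_mul _
  have i6 : Integrable (fun ω => 16 * n ω) μ := hn.const_mul _
  have i12 : Integrable (fun ω => 32 * W * X ω ^ 2 + 32 * W * (X ω * n ω)) μ := i1.add i2
  have i13 : Integrable (fun ω => 32 * W * X ω ^ 2 + 32 * W * (X ω * n ω) +
    32 * (X ω * b ω ^ 2)) μ := i12.add i3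
  have i14 : Integrable (fun ω => 32 * W * X ω ^ 2 + 32 * W * (X ω * n ω) +
    32 * (X ω * b ω ^ 2) + 32 * (b ω ^ 2 * n ω)) μ := i13.add i4
  have i15 : Integrable (fun ω => 32 * W * X ω ^ 2 + 32 * W * (X ω * n ω) +
    32 * (X ω * b ω ^ 2) + 32 * (b ω ^ 2 * n ω) + 16 * X ω) μ := i14.add i5
  have i16 : Integrable (fun ω => 32 * W * X ω ^ 2 + 32 * W * (X ω * n ω) +
    32 * (X ω * b ω ^ 2) + 32 * (b ω ^ 2 * n ω) + 16 * X ω + 16 * n ω) μ := i15.add i6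
  have hK : Integrable K μ := i16.add (integrable_const _)
  have hKint : ∫ ω, K ω ∂μ = 32 * W * ∫ ω, X ω ^ 2 ∂μ + 32 * W * ((∫ ω, X ω ∂μ) * (d * s)) +
      32 * ((∫ ω, X ω ∂μ) * (s * W)) + 32 * ((d + 2) * s ^ 2 * W) + 16 * ∫ ω, X ω ∂μ +
      16 * (d * s) + 2 * s ^ 2 * W := by
    have e1 : ∫ ω, n ω ∂μ = d * s := by simpa [hv] using integral_sum_sq hN
    have e2 : ∫ ω, b ω ^ 2 ∂μ = s * W := by simpa [hv] using integral_linear_sq hN hNindep w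
    have e3 : ∫ ω, b ω ^ 2 * n ω ∂μ = (d + 2) * s ^ 2 * W := by
      simpa [hv] using integral_linear_sq_mul_sum_sq hN hNindep w
    simp only [K]
    rw [integral_add i16 (integrable_const _), integral_add i15 i6, integral_add i14 i5,
      integral_add i13 i4, integral_add i12 i3, integral_add i1 i2]
    simp only [integral_const_mul, integral_const, probReal_univ, one_smul]
    rw [hX_n.integral_fun_mul_eq_mul_integral hx2int.aestronglyMeasurable hn.aestronglyMeasurable,
      hX_b.integral_fun_mul_eq_mul_integral hx2int.aestronglyMeasurable hb.aestronglyMeasurable,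
      e1, e2, e3]
  have hNneg : IdentDistrib N (fun ω i => -N ω i) μ μ := by
    simpa using identDistrib_sign_mul hN hNindep (fun _ => -1) (by simp)
  have hid : IdentDistrib (fun ω => grad ((x ω, y ω), N ω))
      (fun ω => grad ((x ω, y ω), fun i => -N ω i)) μ μ :=
    (IdentDistrib.prodMk (.refl (hxmeas.prodMk hymeas).aemeasurable) hNneg hindep
      (hindep.comp (φ := id) (ψ := fun m : Fin d → ℝ => fun i => -m i)
        measurable_id (by fun_prop))).comp hgrad
  have hgint : Integrable (fun ω => grad ((x ω, y ω), N ω)) μ := by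
    refine (hK.const_mul 2).mono' (by fun_prop) (.of_forall fun ω => ?_)
    rw [Real.norm_of_nonneg (hgrad0 _)]
    linarith [hle ω, hgrad0 ((x ω, y ω), fun i => -N ω i)]
  have hmono := integral_mono (hgint.add (hid.integrable_iff.mp hgint)) (hK.const_mul 2) hle
  simp only [Pi.add_apply] at hmono
  rw [integral_add hgint (hid.integrable_iff.mp hgint), ← hid.integral_eq, integral_const_mul,
    hKint] at hmono
  have hXint0 : 0 ≤ ∫ ω, X ω ∂μ := integral_nonneg hX0
  have hX1 : ∫ ω, X ω ∂μ ≤ 1 := hx2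
  have hX2int0 : 0 ≤ ∫ ω, X ω ^ 2 ∂μ := integral_nonneg fun ω => sq_nonneg _
  have t1 : W * ∫ ω, X ω ^ 2 ∂μ ≤ BW ^ 2 * Bx ^ 4 := mul_le_mul hWB hx4 hX2int0 (by positivity)
  have t2 : W * ∫ ω, X ω ∂μ ≤ BW ^ 2 * 1 := mul_le_mul hWB hX1 hXint0 (by positivity)
  have t3 := mul_le_mul_of_nonneg_right t2 (by positivity : 0 ≤ d * s)
  have t4 := mul_le_mul_of_nonneg_right t2 hs0
  have t5 := mul_le_mul_of_nonneg_right hWB (by positivity : 0 ≤ d * s ^ 2)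
  have t6 := mul_le_mul_of_nonneg_right hWB (by positivity : 0 ≤ s ^ 2)
  have t7 : 0 ≤ BW ^ 2 * s ^ 2 := by positivity
  have hrhs : 32 * BW ^ 2 * (d : ℝ) ^ 3 / R ^ 2 + 98 * BW ^ 2 * (d : ℝ) ^ 2 / R ^ 2 +
      32 * BW ^ 2 * (d : ℝ) ^ 2 / R + 32 * BW ^ 2 * (d : ℝ) / R +
      16 * (d : ℝ) ^ 2 / R + 32 * BW ^ 2 * Bx ^ 4 + 16 =
      32 * (BW ^ 2 * (d * s ^ 2)) + 98 * (BW ^ 2 * s ^ 2) + 32 * (BW ^ 2 * (d * s)) +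
        32 * (BW ^ 2 * s) + 16 * (d * s) + 32 * (BW ^ 2 * Bx ^ 4) + 16 := by
    rw [hs]
    ring
  rw [hrhs]
  change ∫ ω, grad ((x ω, y ω), N ω) ∂μ ≤ _
  linarith
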